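/- Let V be a finite-dimensional vector space over a field k of characteristic 0 and let ⁅·,·⁆, ⁅·,·⁆′ be triple-compatible Lie brackets on V such that (V,⁅·,·⁆) is semisimple. Define V₊ = {v ∈ V : ⁅x,v⁆′ = ⁅x,v⁆ for all x ∈ V} and V₋ = {v ∈ V : ⁅x,v⁆′ = −⁅x,v⁆ for all x ∈ V}. Then V₊ and V₋ are ideals of V for both brackets, V₊ ∩ V₋ = {0}, and V₊ + V₋ = V. -/

import Mathlib

/-!
For triple-compatible Lie brackets on a finite-dimensional vector space
over a field of characteristic 0, with the first structure semisimple
(nondegenerate Killing form), the sets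
`V₊ = {v | ad′_v = ad_v}` and `V₋ = {v | ad′_v = -ad_v}` are ideals for
both brackets, intersect in `{0}`, and together span `V`.
-/

variable {k V : Type*} [Field k] [CharZero k] [AddCommGroup V] [Module k V]
  [FiniteDimensional k V]

/-- `B` is a Lie bracket: alternating bilinear and satisfying the Jacobi identity. -/
def IsLieBracket (B : V →ₗ[k] V →ₗ[k] V) : Prop :=
  (∀ a, B a a = 0) ∧ ∀ a b c, B (B a b) c + B (B b c) a + B (B c a) b = 0

/-- Triple-compatibility of two brackets: `⁅⁅a,b⁆,c⁆ = ⁅⁅a,b⁆′,c⁆′`. -/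
def TripleCompat (B B' : V →ₗ[k] V →ₗ[k] V) : Prop :=
  ∀ a b c, B (B a b) c = B' (B' a b) c

/-- `ad_a x = ⁅x, a⁆`. -/
def lieAd (B : V →ₗ[k] V →ₗ[k] V) (a : V) : V →ₗ[k] V := B.flip a

/-- The Killing form `B(a,b) = tr (ad_a ∘ ad_b)`. -/
noncomputable def killingF (B : V →ₗ[k] V →ₗ[k] V) (a b : V) : k :=
  LinearMap.trace k V (lieAd B a ∘ₗ lieAd B b)

/-- `V₊ = {v : ⁅x,v⁆′ = ⁅x,v⁆ for all x}`. -/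
def Vplus (B B' : V →ₗ[k] V →ₗ[k] V) : Set V :=
  {v : V | ∀ x : V, B' x v = B x v}

/-- `V₋ = {v : ⁅x,v⁆′ = -⁅x,v⁆ for all x}`. -/
def Vminus (B B' : V →ₗ[k] V →ₗ[k] V) : Set V :=
  {v : V | ∀ x : V, B' x v = -B x v}

section

variable {F W : Type*} [Field F] [AddCommGroup W] [Module F W] {B B' : W →ₗ[F] W →ₗ[F] W}

theorem IsLieBracket.skew (hB : IsLieBracket B) (a b : W) : B a b = -B b a := by
  have h := hB.1 (a + b)
  simp only [map_add, LinearMap.add_apply, hB.1, zero_add, add_zero] at h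
  exact eq_neg_of_add_eq_zero_right h

/-- The Jacobi identity, as the derivation rule for right multiplication. -/
theorem IsLieBracket.apply_apply (hB : IsLieBracket B) (x a b : W) :
    B x (B a b) = B (B x a) b + B a (B x b) := by
  have h := hB.2 x a b
  rw [hB.skew (B a b) x, hB.skew (B b x) a, hB.skew b x, map_neg, neg_neg] at h
  rw [← sub_eq_zero, ← neg_eq_zero, ← h]
  abel

theorem IsLieBracket.lieAd_apply (hB : IsLieBracket B) (a b : W) :
    lieAd B (B a b) = lieAd B b * lieAd B a - lieAd B a * lieAd B b := by
  ext x
  change B x (B a b) = B (B x a) b - B (B x b) a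
  rw [hB.apply_apply, hB.skew a (B x b), sub_eq_add_neg]

theorem TripleCompat.lieAd_mul (h : TripleCompat B B') (a b : W) :
    lieAd B a * lieAd B b = lieAd B' a * lieAd B' b := by
  ext x
  exact h x b a

theorem TripleCompat.killingF_eq (h : TripleCompat B B') (a b : W) :
    killingF B a b = killingF B' a b :=
  congrArg (LinearMap.trace F W) (h.lieAd_mul a b)

theorem TripleCompat.lieAd_apply (h : TripleCompat B B') (hB : IsLieBracket B)
    (hB' : IsLieBracket B') (a b : W) : lieAd B (B a b) = lieAd B' (B' a b) := by
  rw [hB.lieAd_apply, hB'.lieAd_apply, h.lieAd_mul, h.lieAd_mul]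

theorem lieAd_injective (hss : ∀ a : W, (∀ b : W, killingF B a b = 0) → a = 0) :
    Function.Injective B.flip := by
  rw [injective_iff_map_eq_zero]
  intro a ha
  refine hss a fun b => ?_
  have h : lieAd B a = 0 := ha
  rw [killingF, h, LinearMap.zero_comp, map_zero]

theorem killingF_invariant (hB : IsLieBracket B) (a b c : W) :
    killingF B (B b c) a = killingF B c (B a b) := by
  change LinearMap.trace F W (lieAd B (B b c) * lieAd B a) =
    LinearMap.trace F W (lieAd B c * lieAd B (B a b))
  rw [hB.lieAd_apply, hB.lieAd_apply, sub_mul, mul_sub, map_sub, map_sub, mul_assoc, mul_assoc,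
    LinearMap.trace_mul_comm F (lieAd B b) (lieAd B c * lieAd B a), mul_assoc]

/-- The Killing form as a bilinear map. -/
noncomputable def killingLin (B : W →ₗ[F] W →ₗ[F] W) : W →ₗ[F] Module.Dual F W :=
  LinearMap.mk₂ F (killingF B)
    (by simp [killingF, lieAd, LinearMap.add_comp])
    (by simp [killingF, lieAd, LinearMap.smul_comp])
    (by simp [killingF, lieAd, LinearMap.comp_add])
    (by simp [killingF, lieAd, LinearMap.comp_smul])

/-- A Lie algebra with nondegenerate Killing form is perfect. -/
theorem eq_top_of_bracket_mem [FiniteDimensional F W] (hB : IsLieBracket B)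
    (hss : ∀ a : W, (∀ b : W, killingF B a b = 0) → a = 0)
    (S : Submodule F W) (hS : ∀ a b, B a b ∈ S) : S = ⊤ := by
  by_contra hne
  obtain ⟨f, hf, hle⟩ := S.exists_le_ker_of_lt_top (lt_top_iff_ne_top.mpr hne)
  have hinj : Function.Injective (killingLin B) := by
    rw [injective_iff_map_eq_zero]
    exact fun a ha => hss a fun b => LinearMap.congr_fun ha b
  obtain ⟨c, rfl⟩ := (LinearMap.injective_iff_surjective_of_finrank_eq_finrank
    Subspace.dual_finrank_eq.symm).mp hinj f
  have hc : c = 0 := by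
    refine (injective_iff_map_eq_zero _).mp (lieAd_injective hss) c ?_
    ext b
    refine hss _ fun a => ?_
    change killingF B (B b c) a = 0
    rw [killingF_invariant hB]
    exact hle (hS a b)
  exact hf (by rw [hc, map_zero])

/-- Triple-compatible brackets, the first semisimple, differ by an involution in the centroid. -/
theorem TripleCompat.exists_involution [FiniteDimensional F W] (h : TripleCompat B B')
    (hB : IsLieBracket B) (hB' : IsLieBracket B')
    (hss : ∀ a : W, (∀ b : W, killingF B a b = 0) → a = 0) :
    ∃ φ : W →ₗ[F] W, (∀ v, φ (φ v) = v) ∧ (∀ a b, B (φ a) b = φ (B a b)) ∧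
      (∀ a b, B a (φ b) = φ (B a b)) ∧ ∀ a b, B' a b = φ (B a b) := by
  have hinj : Function.Injective B'.flip := lieAd_injective (by simpa only [← h.killingF_eq])
  obtain ⟨g, hg⟩ := B'.flip.exists_leftInverse_of_injective (LinearMap.ker_eq_bot.mpr hinj)
  have hrange : (LinearMap.range B'.flip).comap B.flip = ⊤ :=
    eq_top_of_bracket_mem hB hss _ fun a b => ⟨B' a b, (h.lieAd_apply hB hB' a b).symm⟩
  let φ : W →ₗ[F] W := g ∘ₗ B.flip
  have hφ (v : W) : B'.flip (φ v) = B.flip v := by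
    obtain ⟨w, hw⟩ : v ∈ (LinearMap.range B'.flip).comap B.flip := hrange ▸ Submodule.mem_top
    change B'.flip (g (B.flip v)) = B.flip v
    rw [← hw, show g (B'.flip w) = w from LinearMap.congr_fun hg w]
  have hbr (a b : W) : B' a b = φ (B a b) :=
    hinj ((h.lieAd_apply hB hB' a b).symm.trans (hφ _).symm)
  have hr (a b : W) : φ (B a (φ b)) = B a b := by
    rw [← hbr]
    exact LinearMap.congr_fun (hφ b) a
  have hl (a b : W) : φ (B (φ a) b) = B a b := by
    rw [hB.skew, map_neg, hr, ← hB.skew]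
  have hll (a b c : W) : B (B (φ a) b) c = φ (B (B a b) c) := by
    rw [← hl (B (φ a) b) c, hl a b]
  have hrl (a b c : W) : B b (B (φ a) c) = φ (B b (B a c)) := by
    rw [← hr b (B (φ a) c), hl a c]
  have htriple (a b c : W) : φ (φ (B a (B b c))) = B a (B b c) := by
    have hc : B (φ a) (B b c) = φ (B a (B b c)) := by
      rw [hB.apply_apply, hll, hrl, ← map_add, ← hB.apply_apply]
    rw [← hc, hl]
  have hdouble (a b : W) : φ (φ (B a b)) = B a b := by
    have hS := eq_top_of_bracket_mem hB hss (LinearMap.eqLocus (φ ∘ₗ φ ∘ₗ B a) (B a)) (htriple a)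
    exact (hS ▸ Submodule.mem_top : b ∈ LinearMap.eqLocus (φ ∘ₗ φ ∘ₗ B a) (B a))
  refine ⟨φ, fun v => ?_, fun a b => ?_, fun a b => ?_, hbr⟩
  · have hS := eq_top_of_bracket_mem hB hss (LinearMap.eqLocus (φ ∘ₗ φ) LinearMap.id) hdouble
    exact (hS ▸ Submodule.mem_top : v ∈ LinearMap.eqLocus (φ ∘ₗ φ) LinearMap.id)
  · rw [← hdouble, hl]
  · rw [← hdouble, hr]

end

theorem plus_minus_parts_are_ideals_and_split
    (B B' : V →ₗ[k] V →ₗ[k] V)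
    (hB : IsLieBracket B) (hB' : IsLieBracket B')
    (hcompat : TripleCompat B B')
    (hss : ∀ a : V, (∀ b : V, killingF B a b = 0) → a = 0) :
    (∀ x ∈ Vplus B B', ∀ v : V, B x v ∈ Vplus B B') ∧
    (∀ x ∈ Vplus B B', ∀ v : V, B' x v ∈ Vplus B B') ∧
    (∀ x ∈ Vminus B B', ∀ v : V, B x v ∈ Vminus B B') ∧
    (∀ x ∈ Vminus B B', ∀ v : V, B' x v ∈ Vminus B B') ∧
    (Vplus B B' ∩ Vminus B B' = {0}) ∧
    (∀ v : V, ∃ p ∈ Vplus B B', ∃ q ∈ Vminus B B', v = p + q) := by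
  obtain ⟨φ, hφ, hl, hr, hbr⟩ := hcompat.exists_involution hB hB' hss
  have hinj := lieAd_injective hss
  have hp (v : V) : v ∈ Vplus B B' ↔ φ v = v := by
    rw [← hinj.eq_iff, LinearMap.ext_iff]
    simp only [Vplus, Set.mem_ofPred_eq, LinearMap.flip_apply, hr, hbr]
  have hm (v : V) : v ∈ Vminus B B' ↔ φ v = -v := by
    rw [← hinj.eq_iff, LinearMap.ext_iff]
    simp only [Vminus, Set.mem_ofPred_eq, LinearMap.flip_apply, hr, hbr, map_neg,
      LinearMap.neg_apply]
  simp only [hp, hm, hbr, hφ, ← hl, Set.ext_iff, Set.mem_inter_iff, Set.mem_singleton_iff]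
  refine ⟨fun x hx v => by rw [hx], fun x hx v => by rw [hx],
    fun x hx v => by rw [hx, map_neg, LinearMap.neg_apply],
    fun x hx v => by rw [hx, map_neg, LinearMap.neg_apply, neg_neg],
    fun v => ⟨fun ⟨h₁, h₂⟩ => ?_, ?_⟩,
    fun v => ⟨(2⁻¹ : k) • (v + φ v), ?_, (2⁻¹ : k) • (v - φ v), ?_, ?_⟩⟩
  · have h : v = -v := h₁.symm.trans h₂
    rw [eq_neg_iff_add_eq_zero, ← two_smul k] at h
    exact (smul_eq_zero_iff_right two_ne_zero).mp h
  · rintro rfl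
    simp
  · rw [map_smul, map_add, hφ, add_comm]
  · rw [map_smul, map_sub, hφ, ← smul_neg, neg_sub]
  · module
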